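/- Let A ⊆ 2^ω. A set Σ ⊆ ℙ(A) is a maximal antichain of ℙ(A) (pairwise incompatible, and every element of ℙ(A) is compatible with some member of Σ) if and only if: (1) Σ is an antichain, and (2) there exist a countable Y ⊆ 2^ω with Σ ⊆ ℙ(A)_Y and a sequence (T_n : n<ω) enumerating all Y-templates, such that for every n, writing T_n = (p,(t_i,n_i,m_i : i<N)), there exist K < ω, strings (t_i^j : i<N, j<K) in 2^{<ω}, and conditions (q_j : j<K) satisfying: (a) ∏_{i<N}[t_i] = ⋃_{j<K} ∏_{i<N}[t_i^j]; (b) q_j ∈ Σ; (c) q_j ∪ p ∈ ℙ(A); (d) if ⌜y ∈ ⋂_{m<ω} U_{n_i,m}⌝ ∈ q_j then y ∉ [t_i^j]; (e) if ⌜[s] ⊆ U_{n_i,m_i}⌝ ∈ q_j then [t_i^j] ∩ [s] = ∅. (In the paper this is stated for A = B a universal Π⁰₃ set, but the statement depends only on the poset ℙ(A).) -/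

import Mathlib

open Set

/-- Formal sentences for the poset ℙ(A): type (1) `mem x n` is ⌜x ∈ ⋂_{m<ω} U_{n,m}⌝,
type (2) `notMem x n m` is ⌜x ∉ U_{n,m}⌝, type (3) `cylSub s n m` is ⌜[s] ⊆ U_{n,m}⌝. -/
inductive PSentence : Type
  | mem (x : ℕ → Bool) (n : ℕ)
  | notMem (x : ℕ → Bool) (n m : ℕ)
  | cylSub (s : List Bool) (n m : ℕ)

/-- The basic clopen set [s] = {y ∈ 2^ω : s ⊆ y}. -/
def cyl (s : List Bool) : Set (ℕ → Bool) := {y | ∀ i : Fin s.length, y i = s.get i}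

/-- x↾k, the length-k initial segment of x. -/
def restr (x : ℕ → Bool) (k : ℕ) : List Bool := List.ofFn (fun i : Fin k => x i)

/-- Consistency of a set of sentences. -/
def PConsistent (p : Set PSentence) : Prop :=
  (∀ x n k, ¬(PSentence.mem x n ∈ p ∧ PSentence.notMem x n k ∈ p)) ∧
  (∀ x n m k, ¬(PSentence.notMem x n m ∈ p ∧ PSentence.cylSub (restr x k) n m ∈ p))

/-- The poset ℙ(A): finite consistent sets of sentences whose type (1) sentences
only mention points of A. -/
def PP (A : Set (ℕ → Bool)) : Set (Set PSentence) :=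
  {p | p.Finite ∧ (∀ x n, PSentence.mem x n ∈ p → x ∈ A) ∧ PConsistent p}

/-- p and q are compatible iff p ∪ q ∈ ℙ(A). -/
def PCompatible (A : Set (ℕ → Bool)) (p q : Set PSentence) : Prop := p ∪ q ∈ PP A

/-- D is dense in ℙ(A) iff every p ∈ ℙ(A) has an extension (superset) in D. -/
def PDense (A : Set (ℕ → Bool)) (D : Set (Set PSentence)) : Prop :=
  ∀ p ∈ PP A, ∃ q ∈ D, p ⊆ q

/-- A filter on ℙ(A): a nonempty subset of ℙ(A) closed under subsets (in ℙ(A))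
and such that any two members have a common extension in G. -/
def PFilter (A : Set (ℕ → Bool)) (G : Set (Set PSentence)) : Prop :=
  G ⊆ PP A ∧ G.Nonempty ∧
  (∀ p ∈ G, ∀ q ∈ PP A, q ⊆ p → q ∈ G) ∧
  (∀ p ∈ G, ∀ q ∈ G, ∃ r ∈ G, p ⊆ r ∧ q ⊆ r)

/-- A sentence is in G iff it belongs to some condition in G. -/
def SentIn (G : Set (Set PSentence)) (σ : PSentence) : Prop := ∃ p ∈ G, σ ∈ p

/-- U^G_{n,m} = ⋃{[s] : ⌜[s] ⊆ U_{n,m}⌝ ∈ G}. -/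
def Ugen (G : Set (Set PSentence)) (n m : ℕ) : Set (ℕ → Bool) :=
  ⋃ s ∈ {s | SentIn G (PSentence.cylSub s n m)}, cyl s

/-- W^G_n = ⋂_{m<ω} U^G_{n,m}. -/
def Wgen (G : Set (Set PSentence)) (n : ℕ) : Set (ℕ → Bool) := ⋂ m, Ugen G n m

/-- The dense set D_{x,n,m}. -/
def Dxnm (A : Set (ℕ → Bool)) (x : ℕ → Bool) (n m : ℕ) : Set (Set PSentence) :=
  {p ∈ PP A | (∃ k, PSentence.cylSub (restr x k) n m ∈ p) ∨ PSentence.notMem x n m ∈ p}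

/-- The dense set D_{x,n}. -/
def Dxn (A : Set (ℕ → Bool)) (x : ℕ → Bool) (n : ℕ) : Set (Set PSentence) :=
  {p ∈ PP A | (∃ k, PSentence.notMem x n k ∈ p) ∨ PSentence.mem x n ∈ p}

/-- The dense set D_x. -/
def Dx (A : Set (ℕ → Bool)) (x : ℕ → Bool) : Set (Set PSentence) :=
  {p ∈ PP A | ∃ n, PSentence.mem x n ∈ p}

/-- ℙ(A)_Y: the conditions all of whose type (1) and type (2) sentences
mention only points of Y. -/
def PPY (A Y : Set (ℕ → Bool)) : Set (Set PSentence) :=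
  {p | p ∈ PP A ∧ ∀ x, ((∃ n, PSentence.mem x n ∈ p) ∨ (∃ n m, PSentence.notMem x n m ∈ p)) → x ∈ Y}

/-- (p,(t_i,n_i,m_i : i<N)) is a Y-template. -/
def IsTemplate (A Y : Set (ℕ → Bool)) (N : ℕ) (p : Set PSentence)
    (t : Fin N → List Bool) (nn mm : Fin N → ℕ) : Prop :=
  p ∈ PPY A Y ∧
  (∀ i : Fin N, ∀ y, PSentence.mem y (nn i) ∈ p → y ∉ cyl (t i)) ∧
  (∀ i : Fin N, ∀ s, PSentence.cylSub s (nn i) (mm i) ∈ p → cyl s ∩ cyl (t i) = ∅)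

/-- p(x⃗) = p ∪ {⌜x_i ∉ U_{n_i,m_i}⌝ : i < N}. -/
def pvec (p : Set PSentence) {N : ℕ} (nn mm : Fin N → ℕ)
    (x : Fin N → (ℕ → Bool)) : Set PSentence :=
  p ∪ {σ | ∃ i : Fin N, σ = PSentence.notMem (x i) (nn i) (mm i)}

/-- Σ is an antichain in ℙ(A): a set of pairwise incompatible conditions. -/
def PAntichain (A : Set (ℕ → Bool)) (S : Set (Set PSentence)) : Prop :=
  S ⊆ PP A ∧ ∀ p ∈ S, ∀ q ∈ S, p ≠ q → ¬ PCompatible A p q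

/-- Σ is a maximal antichain in ℙ(A). -/
def PMaxAntichain (A : Set (ℕ → Bool)) (S : Set (Set PSentence)) : Prop :=
  PAntichain A S ∧ ∀ p ∈ PP A, ∃ q ∈ S, PCompatible A p q

/-- A Y-template, bundled. -/
structure PTemplate (A Y : Set (ℕ → Bool)) where
  N : ℕ
  p : Set PSentence
  t : Fin N → List Bool
  nn : Fin N → ℕ
  mm : Fin N → ℕ
  isT : IsTemplate A Y N p t nn mm

open Filter Topology

lemma mem_cyl_iff_exists_restr {y : ℕ → Bool} {s : List Bool} :
    y ∈ cyl s ↔ ∃ k, restr y k = s := by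
  constructor
  · intro h
    refine ⟨s.length, List.ext_get (by simp [restr]) fun i h₁ h₂ => ?_⟩
    simpa [restr] using h ⟨i, h₂⟩
  · rintro ⟨k, rfl⟩ i
    exact (List.get_ofFn (fun i : Fin k => y i) i).symm

lemma cyl_restr (x : ℕ → Bool) (k : ℕ) :
    cyl (restr x k) = PiNat.cylinder (E := fun _ => Bool) x k := by
  ext y
  simp only [cyl, restr, PiNat.cylinder, mem_ofPred_eq]
  constructor
  · intro h i hi
    simpa using h ⟨i, by simpa using hi⟩
  · intro h i
    simpa using h i (by simpa using i.2)

lemma self_mem_cyl_restr (x : ℕ → Bool) (k : ℕ) : x ∈ cyl (restr x k) :=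
  mem_cyl_iff_exists_restr.2 ⟨k, rfl⟩

lemma isClopen_cyl (s : List Bool) : IsClopen (cyl s) := by
  have h : cyl s = ⋂ i : Fin s.length, (fun y : ℕ → Bool => y i) ⁻¹' {s.get i} := by
    ext y
    simp [cyl]
  rw [h]
  exact isClopen_iInter_of_finite fun i => (isClopen_discrete _).preimage (continuous_apply _)

lemma eventually_cyl_restr_subset {x : ℕ → Bool} {U : Set (ℕ → Bool)} (hU : IsOpen U)
    (hx : x ∈ U) : ∀ᶠ k in atTop, cyl (restr x k) ⊆ U := by
  obtain ⟨_, ⟨z, k, rfl⟩, hxz, hzU⟩ :=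
    (PiNat.isTopologicalBasis_cylinders (fun _ => Bool)).exists_subset_of_mem_open hx hU
  filter_upwards [eventually_ge_atTop k] with l hl
  rw [cyl_restr]
  refine (PiNat.cylinder_anti x hl).trans ?_
  rwa [PiNat.mem_cylinder_iff_eq.1 hxz]

/-- The points `x` for which `⌜x ∉ U_{n,m}⌝` contradicts a sentence of `p`. -/
def forbidden (p : Set PSentence) (n m : ℕ) : Set (ℕ → Bool) :=
  {y | PSentence.mem y n ∈ p} ∪ ⋃ s ∈ {s | PSentence.cylSub s n m ∈ p}, cyl s

lemma mem_forbidden {p : Set PSentence} {n m : ℕ} {y : ℕ → Bool} :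
    y ∈ forbidden p n m ↔
      PSentence.mem y n ∈ p ∨ ∃ s, PSentence.cylSub s n m ∈ p ∧ y ∈ cyl s := by
  simp [forbidden]

lemma isClosed_forbidden {p : Set PSentence} (hp : p.Finite) (n m : ℕ) :
    IsClosed (forbidden p n m) := by
  refine IsClosed.union (Set.Finite.isClosed ?_) (Set.Finite.isClosed_biUnion ?_ fun s _ =>
    (isClopen_cyl s).isClosed)
  · exact hp.preimage (f := fun y => PSentence.mem y n) fun a _ b _ h => by simpa using h
  · exact hp.preimage (f := fun s => PSentence.cylSub s n m) fun a _ b _ h => by simpa using h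

lemma disjoint_forbidden_iff {p : Set PSentence} {n m : ℕ} {C : Set (ℕ → Bool)} :
    Disjoint C (forbidden p n m) ↔
      (∀ y, PSentence.mem y n ∈ p → y ∉ C) ∧
        ∀ s, PSentence.cylSub s n m ∈ p → C ∩ cyl s = ∅ := by
  simp only [forbidden, disjoint_union_right, disjoint_iUnion_right, ← disjoint_iff_inter_eq_empty]
  refine and_congr ?_ Iff.rfl
  rw [disjoint_right]
  rfl

lemma pConsistent_iff {p : Set PSentence} :
    PConsistent p ↔ ∀ x n m, PSentence.notMem x n m ∈ p → x ∉ forbidden p n m := by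
  simp only [mem_forbidden, mem_cyl_iff_exists_restr]
  constructor
  · rintro ⟨h₁, h₂⟩ x n m hx (h | ⟨_, h, k, rfl⟩)
    · exact h₁ _ _ _ ⟨h, hx⟩
    · exact h₂ _ _ _ _ ⟨hx, h⟩
  · intro h
    exact ⟨fun x n k hx => h x n k hx.2 (.inl hx.1),
      fun x n m k hx => h x n m hx.1 (.inr ⟨_, hx.2, k, rfl⟩)⟩

lemma mem_PP_of_subset {A : Set (ℕ → Bool)} {p q : Set PSentence} (hq : q ∈ PP A) (h : p ⊆ q) :
    p ∈ PP A :=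
  ⟨hq.1.subset h, fun x n hx => hq.2.1 x n (h hx),
    fun x n k hx => hq.2.2.1 x n k ⟨h hx.1, h hx.2⟩,
    fun x n m k hx => hq.2.2.2 x n m k ⟨h hx.1, h hx.2⟩⟩

lemma eventually_disjoint_forbidden {A : Set (ℕ → Bool)} {p : Set PSentence} (hp : p ∈ PP A)
    {x : ℕ → Bool} {n m : ℕ} (hx : PSentence.notMem x n m ∈ p) :
    ∀ᶠ l in atTop, Disjoint (cyl (restr x l)) (forbidden p n m) := by
  simp only [← subset_compl_iff_disjoint_right]
  exact eventually_cyl_restr_subset (isClosed_forbidden hp.1 n m).isOpen_compl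
    (pConsistent_iff.1 hp.2.2 x n m hx)

/-- Replace the points in a sentence by their initial segments of length `l`. -/
def truncate (l : ℕ) : PSentence → ℕ × List Bool × ℕ × ℕ
  | .mem x n => (0, restr x l, n, 0)
  | .notMem x n m => (1, restr x l, n, m)
  | .cylSub s n m => (2, s, n, m)

/-- Whenever `⌜x ∉ U_{n,m}⌝` is in `p`, the length-`l` initial segment of `x` already separates
`x` from the points forbidden by `p`. -/
def SeparatedAt (p : Set PSentence) (l : ℕ) : Prop :=
  ∀ x n m, PSentence.notMem x n m ∈ p → Disjoint (cyl (restr x l)) (forbidden p n m)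

lemma exists_separatedAt {A : Set (ℕ → Bool)} {p : Set PSentence} (hp : p ∈ PP A) :
    ∃ l, SeparatedAt p l := by
  have h : ∀ᶠ l in atTop, ∀ σ ∈ p, ∀ x n m, σ = PSentence.notMem x n m →
      Disjoint (cyl (restr x l)) (forbidden p n m) := by
    rw [eventually_all_finite hp.1]
    rintro (⟨x, n⟩ | ⟨x, n, m⟩ | ⟨s, n, m⟩) hσ
    · simp
    · filter_upwards [eventually_disjoint_forbidden hp hσ] with l hl x' n' m' h
      cases h
      exact hl
    · simp
  obtain ⟨l, hl⟩ := h.exists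
  exact ⟨l, fun x n m hx => hl _ hx x n m rfl⟩

lemma notMem_forbidden_of_truncate_image_eq {p q : Set PSentence} {l : ℕ} (hq : SeparatedAt q l)
    (h : truncate l '' p = truncate l '' q) {x : ℕ → Bool} {n m : ℕ}
    (hx : PSentence.notMem x n m ∈ p) : x ∉ forbidden q n m := by
  have hmem : truncate l (.notMem x n m) ∈ truncate l '' q := h ▸ mem_image_of_mem _ hx
  obtain ⟨σ, hσ, hσx⟩ := hmem
  rcases σ with ⟨y, k⟩ | ⟨y, k, j⟩ | ⟨s, k, j⟩ <;> simp only [truncate, Prod.mk.injEq] at hσx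
  · simp at hσx
  · obtain ⟨-, hy, rfl, rfl⟩ := hσx
    exact disjoint_left.1 (hq y k j hσ) (hy ▸ self_mem_cyl_restr x l)
  · simp at hσx

lemma union_mem_PP_of_truncate_image_eq {A : Set (ℕ → Bool)} {p q : Set PSentence} {l : ℕ}
    (hp : p ∈ PP A) (hq : q ∈ PP A) (hpl : SeparatedAt p l) (hql : SeparatedAt q l)
    (h : truncate l '' p = truncate l '' q) : p ∪ q ∈ PP A := by
  refine ⟨hp.1.union hq.1, fun x n hx => hx.elim (hp.2.1 x n) (hq.2.1 x n), ?_⟩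
  rw [pConsistent_iff]
  intro x n m hx hf
  have hf' : x ∈ forbidden p n m ∨ x ∈ forbidden q n m := by
    rcases mem_forbidden.1 hf with (h | h) | ⟨s, h | h, hs⟩
    · exact .inl (mem_forbidden.2 (.inl h))
    · exact .inr (mem_forbidden.2 (.inl h))
    · exact .inl (mem_forbidden.2 (.inr ⟨s, h, hs⟩))
    · exact .inr (mem_forbidden.2 (.inr ⟨s, h, hs⟩))
  rcases hx with hx | hx <;> rcases hf' with hf | hf
  · exact pConsistent_iff.1 hp.2.2 x n m hx hf
  · exact notMem_forbidden_of_truncate_image_eq hql h hx hf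
  · exact notMem_forbidden_of_truncate_image_eq hpl h.symm hx hf
  · exact pConsistent_iff.1 hq.2.2 x n m hx hf

/-- The poset `ℙ(A)` satisfies the countable chain condition. -/
lemma PAntichain.countable {A : Set (ℕ → Bool)} {S : Set (Set PSentence)} (hS : PAntichain A S) :
    S.Countable := by
  have hcover : S ⊆ ⋃ l, {p ∈ S | SeparatedAt p l} := fun p hp =>
    have ⟨l, hl⟩ := exists_separatedAt (hS.1 hp)
    mem_iUnion.2 ⟨l, hp, hl⟩
  refine (countable_iUnion fun l => ?_).mono hcover
  have hmaps : MapsTo (fun p => truncate l '' p) {p ∈ S | SeparatedAt p l}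
      {c | c.Finite ∧ c ⊆ univ} :=
    fun p hp => ⟨(hS.1 hp.1).1.image _, subset_univ _⟩
  refine hmaps.countable_of_injOn (fun p hp q hq h => ?_)
    (countable_ofPred_finite_subset (to_countable univ))
  by_contra hne
  exact hS.2 p hp.1 q hq.1 hne
    (union_mem_PP_of_truncate_image_eq (hS.1 hp.1) (hS.1 hq.1) hp.2 hq.2 h)

/-- The points mentioned in a sentence. -/
def PSentence.points : PSentence → Set (ℕ → Bool)
  | .mem x _ => {x}
  | .notMem x _ _ => {x}
  | .cylSub _ _ _ => ∅

lemma PSentence.countable_points (σ : PSentence) : σ.points.Countable := by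
  cases σ <;> simp [PSentence.points]

lemma mem_PPY_iff {A Y : Set (ℕ → Bool)} {p : Set PSentence} :
    p ∈ PPY A Y ↔ p ∈ PP A ∧ ∀ σ ∈ p, σ.points ⊆ Y := by
  refine and_congr_right fun _ => ⟨fun h σ hσ => ?_, fun h x hx => ?_⟩
  · rcases σ with ⟨x, n⟩ | ⟨x, n, m⟩ | ⟨s, n, m⟩
    · simpa [PSentence.points] using h x (.inl ⟨n, hσ⟩)
    · simpa [PSentence.points] using h x (.inr ⟨n, m, hσ⟩)
    · simp [PSentence.points]
  · rcases hx with ⟨n, hx⟩ | ⟨n, m, hx⟩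
    · simpa [PSentence.points] using h _ hx
    · simpa [PSentence.points] using h _ hx

lemma countable_setOf_points_subset {Y : Set (ℕ → Bool)} (hY : Y.Countable) :
    {σ : PSentence | σ.points ⊆ Y}.Countable := by
  have := hY.to_subtype
  refine ((countable_range fun a : Y × ℕ => PSentence.mem a.1 a.2).union
    ((countable_range fun a : Y × ℕ × ℕ => PSentence.notMem a.1 a.2.1 a.2.2).union
      (countable_range fun a : List Bool × ℕ × ℕ => PSentence.cylSub a.1 a.2.1 a.2.2))).mono ?_
  rintro (⟨x, n⟩ | ⟨x, n, m⟩ | ⟨s, n, m⟩) h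
  · exact .inl ⟨(⟨x, h rfl⟩, n), rfl⟩
  · exact .inr (.inl ⟨(⟨x, h rfl⟩, n, m), rfl⟩)
  · exact .inr (.inr ⟨(s, n, m), rfl⟩)

lemma countable_PPY (A : Set (ℕ → Bool)) {Y : Set (ℕ → Bool)} (hY : Y.Countable) :
    (PPY A Y).Countable := by
  refine (countable_ofPred_finite_subset (countable_setOf_points_subset hY)).mono fun p hp => ?_
  exact ⟨hp.1.1, (mem_PPY_iff.1 hp).2⟩

lemma countable_PTemplate (A : Set (ℕ → Bool)) {Y : Set (ℕ → Bool)} (hY : Y.Countable) :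
    Countable (PTemplate A Y) := by
  have := (countable_PPY A hY).to_subtype
  let f : PTemplate A Y →
      Σ N : ℕ, PPY A Y × (Fin N → List Bool) × (Fin N → ℕ) × (Fin N → ℕ) :=
    fun τ => ⟨τ.N, ⟨τ.p, τ.isT.1⟩, τ.t, τ.nn, τ.mm⟩
  refine Function.Injective.countable (f := f) ?_
  rintro ⟨N, p, t, nn, mm, h⟩ ⟨N', p', t', nn', mm', h'⟩ heq
  simp only [f, Sigma.mk.injEq] at heq
  obtain ⟨rfl, heq⟩ := heq
  simp only [heq_eq_eq, Prod.mk.injEq, Subtype.mk.injEq] at heq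
  obtain ⟨rfl, rfl, rfl, rfl⟩ := heq
  rfl

lemma empty_mem_PP (A : Set (ℕ → Bool)) : ∅ ∈ PP A :=
  ⟨finite_empty, by simp, by simp, by simp⟩

instance (A Y : Set (ℕ → Bool)) : Nonempty (PTemplate A Y) :=
  ⟨⟨0, ∅, Fin.elim0, Fin.elim0, Fin.elim0, mem_PPY_iff.2 ⟨empty_mem_PP A, by simp⟩,
    fun i => i.elim0, fun i => i.elim0⟩⟩

lemma isTemplate_iff {A Y : Set (ℕ → Bool)} {N : ℕ} {p : Set PSentence}
    {t : Fin N → List Bool} {nn mm : Fin N → ℕ} :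
    IsTemplate A Y N p t nn mm ↔
      p ∈ PPY A Y ∧ ∀ i, Disjoint (cyl (t i)) (forbidden p (nn i) (mm i)) := by
  simp only [IsTemplate, disjoint_forbidden_iff, forall_and, inter_comm]

/-- Adding finitely many sentences `⌜x_i ∉ U_{n_i,m_i}⌝` with `x_i` not forbidden by `p`
preserves membership in `ℙ(A)`. -/
lemma pvec_mem_PP {A : Set (ℕ → Bool)} {p : Set PSentence} (hp : p ∈ PP A) {N : ℕ}
    {nn mm : Fin N → ℕ} {x : Fin N → ℕ → Bool}
    (hx : ∀ i, x i ∉ forbidden p (nn i) (mm i)) : pvec p nn mm x ∈ PP A := by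
  have hforb : ∀ n m, forbidden (pvec p nn mm x) n m = forbidden p n m := by
    intro n m
    ext y
    simp [mem_forbidden, pvec]
  refine ⟨hp.1.union ?_, fun y n hy => hp.2.1 y n (by simpa [pvec] using hy), ?_⟩
  · refine (finite_range fun i => PSentence.notMem (x i) (nn i) (mm i)).subset ?_
    rintro _ ⟨i, rfl⟩
    exact ⟨i, rfl⟩
  · rw [pConsistent_iff]
    rintro y n m (hy | ⟨i, hi⟩)
    · rw [hforb]
      exact pConsistent_iff.1 hp.2.2 y n m hy
    · cases hi
      rw [hforb]
      exact hx i

/-- A family of strings and members of `S` witnessing that every instance `p(x⃗)` of the template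
`τ` is compatible with a member of `S`. -/
def HasCover (A : Set (ℕ → Bool)) (S : Set (Set PSentence)) {Y : Set (ℕ → Bool)}
    (τ : PTemplate A Y) : Prop :=
  ∃ (K : ℕ) (t' : Fin τ.N → Fin K → List Bool) (q : Fin K → Set PSentence),
    ({x : Fin τ.N → (ℕ → Bool) | ∀ i, x i ∈ cyl (τ.t i)} =
      ⋃ j : Fin K, {x | ∀ i, x i ∈ cyl (t' i j)}) ∧
    (∀ j : Fin K, q j ∈ S) ∧
    (∀ j : Fin K, q j ∪ τ.p ∈ PP A) ∧
    (∀ (j : Fin K) (i : Fin τ.N) (y : ℕ → Bool),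
      PSentence.mem y (τ.nn i) ∈ q j → y ∉ cyl (t' i j)) ∧
    (∀ (j : Fin K) (i : Fin τ.N) (s : List Bool),
      PSentence.cylSub s (τ.nn i) (τ.mm i) ∈ q j → cyl (t' i j) ∩ cyl s = ∅)

lemma hasCover_of_forall_compatible {A : Set (ℕ → Bool)} {S : Set (Set PSentence)}
    {Y : Set (ℕ → Bool)} (hS : ∀ p ∈ PP A, ∃ q ∈ S, PCompatible A p q) (τ : PTemplate A Y) :
    HasCover A S τ := by
  obtain ⟨N, p, t, nn, mm, hτ⟩ := τ
  rw [isTemplate_iff] at hτ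
  obtain ⟨hp, hdisj⟩ := hτ
  set box : Set (Fin N → ℕ → Bool) := {x | ∀ i, x i ∈ cyl (t i)} with hbox
  have hcompact : IsCompact box := by
    have : box = univ.pi fun i => cyl (t i) := by ext; simp [hbox]
    rw [this]
    exact (isClosed_set_pi fun i _ => (isClopen_cyl _).isClosed).isCompact
  have hlocal : ∀ x ∈ box, ∃ (q : Set PSentence) (l : ℕ), q ∈ S ∧ q ∪ p ∈ PP A ∧
      ∀ i, cyl (restr (x i) l) ⊆ cyl (t i) ∧
        Disjoint (cyl (restr (x i) l)) (forbidden q (nn i) (mm i)) := by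
    intro x hx
    obtain ⟨q, hqS, hq⟩ :=
      hS _ (pvec_mem_PP hp.1 fun i => disjoint_left.1 (hdisj i) (hx i))
    have hq' : q ∈ PP A := mem_PP_of_subset hq subset_union_right
    have hev : ∀ᶠ l in atTop, ∀ i, cyl (restr (x i) l) ⊆ cyl (t i) ∧
        Disjoint (cyl (restr (x i) l)) (forbidden q (nn i) (mm i)) := by
      rw [eventually_all]
      intro i
      refine (eventually_cyl_restr_subset (isClopen_cyl _).isOpen (hx i)).and ?_
      have hsub : insert (PSentence.notMem (x i) (nn i) (mm i)) q ⊆ pvec p nn mm x ∪ q :=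
        insert_subset (.inl (.inr ⟨i, rfl⟩)) subset_union_right
      filter_upwards [eventually_disjoint_forbidden (mem_PP_of_subset hq hsub)
        (mem_insert _ _)] with l hl
      refine hl.mono_right fun y hy => ?_
      simpa [mem_forbidden] using hy
    obtain ⟨l, hl⟩ := hev.exists
    refine ⟨q, l, hqS, mem_PP_of_subset hq ?_, hl⟩
    exact union_subset subset_union_right (subset_union_left.trans subset_union_left)
  choose! q l hqS hqp hql using hlocal
  obtain ⟨F, hF, hcover⟩ := hcompact.elim_nhds_subcover
    (fun x => univ.pi fun i => cyl (restr (x i) (l x))) fun x _ =>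
      set_pi_mem_nhds finite_univ fun i _ =>
        (isClopen_cyl _).isOpen.mem_nhds (self_mem_cyl_restr _ _)
  let e := F.equivFin.symm
  have he : ∀ j, (e j : Fin N → ℕ → Bool) ∈ box := fun j => hF _ (e j).2
  have hdq : ∀ j i, _ := fun j i => disjoint_forbidden_iff.1 (hql _ (he j) i).2
  refine ⟨F.card, fun i j => restr ((e j : Fin N → ℕ → Bool) i) (l (e j)), fun j => q (e j),
    ?_, fun j => hqS _ (he j), fun j => hqp _ (he j),
    fun j i => (hdq j i).1, fun j i => (hdq j i).2⟩
  refine Subset.antisymm (fun x hx => ?_) (iUnion_subset fun j x hx i =>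
    (hql _ (he j) i).1 (hx i))
  obtain ⟨z, hz, hxz⟩ := mem_iUnion₂.1 (hcover hx)
  refine mem_iUnion.2 ⟨F.equivFin ⟨z, hz⟩, fun i => ?_⟩
  simpa [e] using hxz i (mem_univ i)

lemma exists_compatible_of_forall_hasCover {A : Set (ℕ → Bool)} {S : Set (Set PSentence)}
    {Y : Set (ℕ → Bool)} (hSY : S ⊆ PPY A Y) (h : ∀ τ : PTemplate A Y, HasCover A S τ)
    {p : Set PSentence} (hp : p ∈ PP A) : ∃ q ∈ S, PCompatible A p q := by
  obtain ⟨l, hl⟩ := exists_separatedAt hp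
  set I : Set ((ℕ → Bool) × ℕ × ℕ) := {a | PSentence.notMem a.1 a.2.1 a.2.2 ∈ p}
  have hIfin : I.Finite := hp.1.preimage
    (f := fun a : (ℕ → Bool) × ℕ × ℕ => PSentence.notMem a.1 a.2.1 a.2.2) (by
      rintro ⟨a, b, c⟩ - ⟨a', b', c'⟩ - h
      simpa using h)
  obtain ⟨N, a, ha⟩ := hIfin.fin_param
  have haI : ∀ i, PSentence.notMem (a i).1 (a i).2.1 (a i).2.2 ∈ p := fun i => by
    have : a i ∈ I := ha.2 ▸ mem_range_self i
    exact this
  set p₀ : Set PSentence := {σ ∈ p | σ.points ⊆ Y}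
  have hp₀p : p₀ ⊆ p := sep_subset _ _
  have hforb : ∀ n m, forbidden p₀ n m ⊆ forbidden p n m := fun n m y hy =>
    mem_forbidden.2 ((mem_forbidden.1 hy).imp (fun h => hp₀p h)
      fun ⟨s, hs, hys⟩ => ⟨s, hp₀p hs, hys⟩)
  obtain ⟨K, t', q, hcover, hqS, hqp, hd, he⟩ := h ⟨N, p₀, fun i => restr (a i).1 l,
    fun i => (a i).2.1, fun i => (a i).2.2, isTemplate_iff.2
      ⟨mem_PPY_iff.2 ⟨mem_PP_of_subset hp hp₀p, fun σ hσ => hσ.2⟩,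
        fun i => (hl _ _ _ (haI i)).mono_right (hforb _ _)⟩⟩
  dsimp only at t' hcover hqp hd he
  have hmem : (fun i => (a i).1) ∈ ⋃ j : Fin K, {x | ∀ i, x i ∈ cyl (t' i j)} :=
    hcover ▸ fun i => self_mem_cyl_restr _ _
  obtain ⟨j, hj⟩ := mem_iUnion.1 hmem
  have hqY := mem_PPY_iff.1 (hSY (hqS j))
  refine ⟨q j, hqS j, hp.1.union hqY.1.1,
    fun x n hx => hx.elim (hp.2.1 x n) (hqY.1.2.1 x n), pConsistent_iff.2 ?_⟩
  intro x n m hx hf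
  rcases hx with hx | hx
  · obtain ⟨i, hi⟩ : (x, n, m) ∈ range a := ha.2 ▸ hx
    have hq : x ∉ forbidden (q j) n m := by
      have := disjoint_left.1 (disjoint_forbidden_iff.2 ⟨hd j i, he j i⟩) (hj i)
      simpa only [hi] using this
    have hpx := pConsistent_iff.1 hp.2.2 x n m hx
    simp only [mem_forbidden, not_or, not_exists, not_and] at hq hpx
    rcases mem_forbidden.1 hf with (h | h) | ⟨s, h | h, hs⟩
    exacts [hpx.1 h, hq.1 h, hpx.2 s h hs, hq.2 s h hs]
  · have hxY : x ∈ Y := hqY.2 _ hx rfl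
    refine pConsistent_iff.1 (hqp j).2.2 x n m (.inl hx) (mem_forbidden.2 ?_)
    rcases mem_forbidden.1 hf with (h | h) | ⟨s, h | h, hs⟩
    · exact .inl (.inr ⟨h, singleton_subset_iff.2 hxY⟩)
    · exact .inl (.inl h)
    · exact .inr ⟨s, .inr ⟨h, empty_subset _⟩, hs⟩
    · exact .inr ⟨s, .inl h, hs⟩

/-- characterization of maximal antichains of ℙ(A). -/
theorem maxAntichain_characterization (A : Set (ℕ → Bool))
    (S : Set (Set PSentence)) (hS : S ⊆ PP A) :
    PMaxAntichain A S ↔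
      (PAntichain A S ∧
        ∃ Y : Set (ℕ → Bool), Y.Countable ∧ S ⊆ PPY A Y ∧
          ∃ T : ℕ → PTemplate A Y, Function.Surjective T ∧
            ∀ n : ℕ, ∃ (K : ℕ) (t' : Fin (T n).N → Fin K → List Bool)
                (q : Fin K → Set PSentence),
              ({x : Fin (T n).N → (ℕ → Bool) | ∀ i, x i ∈ cyl ((T n).t i)} =
                ⋃ j : Fin K, {x | ∀ i, x i ∈ cyl (t' i j)}) ∧
              (∀ j : Fin K, q j ∈ S) ∧
              (∀ j : Fin K, q j ∪ (T n).p ∈ PP A) ∧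
              (∀ (j : Fin K) (i : Fin (T n).N) (y : ℕ → Bool),
                PSentence.mem y ((T n).nn i) ∈ q j → y ∉ cyl (t' i j)) ∧
              (∀ (j : Fin K) (i : Fin (T n).N) (s : List Bool),
                PSentence.cylSub s ((T n).nn i) ((T n).mm i) ∈ q j →
                  cyl (t' i j) ∩ cyl s = ∅)) := by
  constructor
  · rintro ⟨hanti, hmax⟩
    set Y : Set (ℕ → Bool) := ⋃ q ∈ S, ⋃ σ ∈ q, σ.points
    have hY : Y.Countable := hanti.countable.biUnion fun q hq =>
      (hS hq).1.countable.biUnion fun σ _ => σ.countable_points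
    have := countable_PTemplate A hY
    obtain ⟨T, hT⟩ := exists_surjective_nat (PTemplate A Y)
    exact ⟨hanti, Y, hY, fun q hq => mem_PPY_iff.2 ⟨hS hq, fun σ hσ =>
      (subset_biUnion_of_mem (u := fun σ => PSentence.points σ) hσ).trans
        (subset_biUnion_of_mem (u := fun q => ⋃ σ ∈ q, PSentence.points σ) hq)⟩, T, hT,
      fun n => hasCover_of_forall_compatible hmax (T n)⟩
  · rintro ⟨hanti, Y, -, hSY, T, hT, hcover⟩
    exact ⟨hanti, fun p hp => exists_compatible_of_forall_hasCover hSY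
      (hT.forall.2 hcover) hp⟩
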